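/- Let G be an infinite group and let S be a G-set on which every point has finite stabilizer. Then for every natural number m and every family A₁, …, A_m of finite subsets of S there exist g₁, …, g_m ∈ G such that the translates g₁ • A₁, …, g_m • A_m are pairwise disjoint (g_i • A_i ∩ g_j • A_j = ∅ whenever i ≠ j). -/

import Mathlib

open scoped Pointwise

theorem finite_transporter {G : Type*} [Group G] {S : Type*} [MulAction G S]
    (hprop : ∀ s : S, Finite (MulAction.stabilizer G s)) (b c : S) :
    {g : G | g • b = c}.Finite := by
  by_cases h : ∃ g₀ : G, g₀ • b = c
  · obtain ⟨g₀, h₀⟩ := h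
    have hf : (MulAction.stabilizer G b : Set G).Finite := Set.finite_coe_iff.mp (hprop b)
    refine (hf.image (fun x => g₀ * x)).subset ?_
    intro g hg
    refine ⟨g₀⁻¹ * g, ?_, by simp⟩
    have hg' : g • b = c := hg
    simp [MulAction.mem_stabilizer_iff, mul_smul, hg', ← h₀]
  · convert Set.finite_empty
    ext g
    simp only [Set.mem_setOf_eq, Set.mem_empty_iff_false, iff_false]
    exact fun hg => h ⟨g, hg⟩

theorem exists_disjoint_translate {G : Type*} [Group G] [Infinite G] {S : Type*} [MulAction G S]
    (hprop : ∀ s : S, Finite (MulAction.stabilizer G s)) (B C : Set S)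
    (hB : B.Finite) (hC : C.Finite) : ∃ g : G, (g • B) ∩ C = ∅ := by
  have hf : (⋃ b ∈ B, ⋃ c ∈ C, {g : G | g • b = c}).Finite :=
    hB.biUnion fun b _ => hC.biUnion fun c _ => finite_transporter hprop b c
  obtain ⟨g, hg⟩ := hf.exists_notMem
  refine ⟨g, ?_⟩
  rw [Set.eq_empty_iff_forall_notMem]
  rintro x ⟨⟨b, hb, rfl⟩, hx⟩
  apply hg
  simp only [Set.mem_iUnion]
  exact ⟨b, hb, _, hx, rfl⟩

theorem stmt5 (G : Type*) [Group G] [Infinite G]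
    (S : Type*) [MulAction G S]
    (hprop : ∀ s : S, Finite (MulAction.stabilizer G s))
    (m : ℕ) (A : Fin m → Set S) (hA : ∀ i, (A i).Finite) :
    ∃ g : Fin m → G, ∀ i j : Fin m, i ≠ j → (g i • A i) ∩ (g j • A j) = ∅ := by
  induction m with
  | zero => exact ⟨fun _ => 1, fun i => i.elim0⟩
  | succ n ih =>
    obtain ⟨g, hg⟩ := ih (fun i => A i.succ) (fun i => hA _)
    obtain ⟨x, hx⟩ := exists_disjoint_translate hprop (A 0) (⋃ i, g i • A (Fin.succ i)) (hA 0)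
      (Set.finite_iUnion fun i => (hA _).smul_set)
    have key : ∀ i, (x • A 0) ∩ (g i • A (Fin.succ i)) = ∅ := fun i =>
      Set.subset_eq_empty
        (Set.inter_subset_inter_right _ (Set.subset_iUnion (fun i => g i • A (Fin.succ i)) i)) hx
    refine ⟨Fin.cons x g, fun i j => ?_⟩
    refine Fin.cases ?_ (fun i => ?_) i <;> refine Fin.cases ?_ (fun j => ?_) j
    · intro h; exact absurd rfl h
    · intro _; simpa using key j
    · intro _; rw [Set.inter_comm]; simpa using key i
    · intro h
      simpa using hg i j (fun e => h (by rw [e]))
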